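/- arXiv:2109.11671 — 6 statements merged into one kernel-verified Lean document; each statement's English description precedes it below -/
import Mathlib

section
/- Let k ∈ ℕ and let (V, C, e) be a k-AOU space. Then C_k^{k-min} = C, and the triple (V, {C_n^{k-min}}_{n≥1}, e) is an operator system; that is, {C_n^{k-min}} is a matrix ordering on V (each C_n^{k-min} is a proper cone and α* C_n^{k-min} α ⊆ C_m^{k-min} for all α ∈ M_{n,m}(ℂ)) and I_n ⊗ e is an Archimedean order unit for (M_n(V), C_n^{k-min}) for every n. -/
open scoped ComplexConjugate ComplexOrder

noncomputable section

universe u v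

/-- The diagonal matrix `I_n ⊗ e` in `M_n(V)`. -/
def unitMat {V : Type u} [AddCommGroup V] (n : ℕ) (e : V) : Matrix (Fin n) (Fin n) V :=
  Matrix.of fun i j => if i = j then e else 0

/-- The conjugation `α* x α ∈ M_m(V)` of `x ∈ M_n(V)` by a scalar matrix `α ∈ M_{n,m}(ℂ)`. -/
def conjAct {V : Type u} [AddCommGroup V] [Module ℂ V] {n m : ℕ}
    (α : Matrix (Fin n) (Fin m) ℂ) (x : Matrix (Fin n) (Fin n) V) :
    Matrix (Fin m) (Fin m) V :=
  Matrix.of fun i j => ∑ p : Fin n, ∑ q : Fin n, (conj (α p i) * α q j) • x p q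

section Defs

variable {V : Type u} [AddCommGroup V] [Module ℂ V] [StarAddMonoid V] [StarModule ℂ V]

/-- `(V, C, e)` is a `k`-AOU space. -/
structure IsKAOU (k : ℕ) (C : Set (Matrix (Fin k) (Fin k) V)) (e : V) : Prop where
  herm : ∀ x ∈ C, star x = x
  add_mem : ∀ x ∈ C, ∀ y ∈ C, x + y ∈ C
  smul_mem : ∀ r : ℝ, 0 ≤ r → ∀ x ∈ C, (r : ℂ) • x ∈ C
  proper : ∀ x ∈ C, -x ∈ C → x = 0
  compat : ∀ α : Matrix (Fin k) (Fin k) ℂ, ∀ x ∈ C, conjAct α x ∈ C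
  orderUnit : ∀ x : Matrix (Fin k) (Fin k) V, star x = x →
    ∃ r : ℝ, 0 < r ∧ (r : ℂ) • unitMat k e - x ∈ C
  arch : ∀ x : Matrix (Fin k) (Fin k) V,
    (∀ r : ℝ, 0 < r → x + (r : ℂ) • unitMat k e ∈ C) → x ∈ C

/-- A matrix ordering on the `*`-vector space `V`. -/
structure IsMatrixOrdering (C : ∀ n : ℕ, Set (Matrix (Fin n) (Fin n) V)) : Prop where
  herm : ∀ n, ∀ x ∈ C n, star x = x
  add_mem : ∀ n, ∀ x ∈ C n, ∀ y ∈ C n, x + y ∈ C n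
  smul_mem : ∀ n, ∀ r : ℝ, 0 ≤ r → ∀ x ∈ C n, (r : ℂ) • x ∈ C n
  proper : ∀ n, ∀ x ∈ C n, -x ∈ C n → x = 0
  compat : ∀ n m : ℕ, ∀ α : Matrix (Fin n) (Fin m) ℂ, ∀ x ∈ C n, conjAct α x ∈ C m

/-- `(V, {C_n}, e)` is an (abstract) operator system. -/
structure IsOperatorSystem (C : ∀ n : ℕ, Set (Matrix (Fin n) (Fin n) V)) (e : V)
    extends IsMatrixOrdering C : Prop where
  orderUnit : ∀ n : ℕ, ∀ x : Matrix (Fin n) (Fin n) V, star x = x →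
    ∃ r : ℝ, 0 < r ∧ (r : ℂ) • unitMat n e - x ∈ C n
  arch : ∀ n : ℕ, ∀ x : Matrix (Fin n) (Fin n) V,
    (∀ r : ℝ, 0 < r → x + (r : ℂ) • unitMat n e ∈ C n) → x ∈ C n

/-- The cones `C_n^{k-min}` associated to a `k`-AOU space `(V, C, e)`. -/
def kMinCone (k : ℕ) (C : Set (Matrix (Fin k) (Fin k) V)) (n : ℕ) :
    Set (Matrix (Fin n) (Fin n) V) :=
  {x | star x = x ∧ ∀ α : Matrix (Fin n) (Fin k) ℂ, conjAct α x ∈ C}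

/-- `{𝒞_n}` is an extension of the `k`-AOU space `(V, C, e)`: a matrix ordering with
`𝒞_k = C` making `(V, {𝒞_n}, e)` an operator system. -/
def IsExtension (k : ℕ) (C : Set (Matrix (Fin k) (Fin k) V)) (e : V)
    (𝒞 : ∀ n : ℕ, Set (Matrix (Fin n) (Fin n) V)) : Prop :=
  IsOperatorSystem 𝒞 e ∧ 𝒞 k = C

end Defs

section UnitMat

variable {V : Type u} [AddCommGroup V] {n : ℕ}

lemma unitMat_add (a b : V) : unitMat n (a + b) = unitMat n a + unitMat n b := by
  ext i j
  by_cases h : i = j <;> simp [unitMat, h]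

lemma unitMat_neg (a : V) : unitMat n (-a) = -unitMat n a := by
  ext i j
  by_cases h : i = j <;> simp [unitMat, h]

lemma star_unitMat [StarAddMonoid V] {a : V} (ha : star a = a) :
    star (unitMat n a) = unitMat n a := by
  ext i j
  by_cases h : i = j
  · simp [unitMat, Matrix.star_apply, h, ha]
  · simp [unitMat, Matrix.star_apply, h, Ne.symm h]

end UnitMat

section ConjAct

variable {V : Type u} [AddCommGroup V] [Module ℂ V] {n m l : ℕ}

lemma conjAct_apply (α : Matrix (Fin n) (Fin m) ℂ) (x : Matrix (Fin n) (Fin n) V) (i j : Fin m) :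
    conjAct α x i j = ∑ p : Fin n, ∑ q : Fin n, (conj (α p i) * α q j) • x p q := rfl

lemma conjAct_add (α : Matrix (Fin n) (Fin m) ℂ) (x y : Matrix (Fin n) (Fin n) V) :
    conjAct α (x + y) = conjAct α x + conjAct α y := by
  ext i j
  simp [conjAct_apply, smul_add, Finset.sum_add_distrib]

lemma conjAct_smul (α : Matrix (Fin n) (Fin m) ℂ) (c : ℂ) (x : Matrix (Fin n) (Fin n) V) :
    conjAct α (c • x) = c • conjAct α x := by
  ext i j
  simp [conjAct_apply, Finset.smul_sum, smul_comm c]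

lemma conjAct_neg (α : Matrix (Fin n) (Fin m) ℂ) (x : Matrix (Fin n) (Fin n) V) :
    conjAct α (-x) = -conjAct α x := by
  ext i j
  simp [conjAct_apply]

lemma conjAct_one (x : Matrix (Fin n) (Fin n) V) : conjAct 1 x = x := by
  ext i j
  simp [conjAct_apply, Matrix.one_apply, ite_smul]

lemma conjAct_conjAct (α : Matrix (Fin n) (Fin m) ℂ) (β : Matrix (Fin m) (Fin l) ℂ)
    (x : Matrix (Fin n) (Fin n) V) : conjAct β (conjAct α x) = conjAct (α * β) x := by
  ext i j
  simp only [conjAct_apply, Matrix.mul_apply, map_sum, map_mul, Finset.smul_sum, smul_smul,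
    Finset.sum_mul_sum, Finset.sum_smul]
  have h : ∀ f : Fin m → Fin m → Fin n → Fin n → V,
      ∑ p, ∑ q, ∑ s, ∑ t, f p q s t = ∑ s, ∑ t, ∑ p, ∑ q, f p q s t := by
    intro f
    calc _ = ∑ p, ∑ s, ∑ q, ∑ t, f p q s t :=
          Finset.sum_congr rfl fun _ _ => Finset.sum_comm
      _ = ∑ s, ∑ p, ∑ q, ∑ t, f p q s t := Finset.sum_comm
      _ = ∑ s, ∑ p, ∑ t, ∑ q, f p q s t := Finset.sum_congr rfl fun _ _ =>
          Finset.sum_congr rfl fun _ _ => Finset.sum_comm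
      _ = _ := Finset.sum_congr rfl fun _ _ => Finset.sum_comm
  rw [h]
  refine Finset.sum_congr rfl fun s _ => Finset.sum_congr rfl fun t _ =>
    Finset.sum_congr rfl fun p _ => Finset.sum_congr rfl fun q _ => ?_
  congr 1
  ring

lemma star_conjAct [StarAddMonoid V] [StarModule ℂ V] (α : Matrix (Fin n) (Fin m) ℂ)
    (x : Matrix (Fin n) (Fin n) V) : star (conjAct α x) = conjAct α (star x) := by
  ext i j
  simp only [Matrix.star_apply, conjAct_apply, star_sum, star_smul, star_mul']
  rw [Finset.sum_comm]
  simp [mul_comm]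

/-- The rank-one matrix `u* a u` for a row vector `u` and `a ∈ V`. -/
def rankOne (u : Fin n → ℂ) (a : V) : Matrix (Fin n) (Fin n) V :=
  Matrix.of fun i j => (conj (u i) * u j) • a

lemma rankOne_apply (u : Fin n → ℂ) (a : V) (i j : Fin n) :
    rankOne u a i j = (conj (u i) * u j) • a := rfl

lemma conjAct_rankOne (α : Matrix (Fin n) (Fin m) ℂ) (u : Fin n → ℂ) (a : V) :
    conjAct α (rankOne u a) = rankOne (Matrix.vecMul u α) a := by
  ext i j
  simp only [conjAct_apply, rankOne_apply, Matrix.vecMul, dotProduct, map_sum, map_mul, smul_smul,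
    Finset.sum_mul_sum, Finset.sum_smul]
  refine Finset.sum_congr rfl fun s _ => Finset.sum_congr rfl fun t _ => ?_
  congr 1
  ring

lemma star_rankOne [StarAddMonoid V] [StarModule ℂ V] (u : Fin n → ℂ) {a : V} (ha : star a = a) :
    star (rankOne u a) = rankOne u a := by
  ext i j
  simp [Matrix.star_apply, rankOne_apply, star_smul, ha, mul_comm]

lemma unitMat_smul (c : ℂ) (a : V) : unitMat n (c • a) = c • unitMat n a := by
  ext i j
  by_cases h : i = j <;> simp [unitMat, h]

lemma unitMat_eq_sum_rankOne (a : V) :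
    unitMat n a = ∑ p : Fin n, rankOne (Pi.single p 1) a := by
  ext i j
  simp only [unitMat, Matrix.of_apply, Matrix.sum_apply, rankOne_apply]
  rw [Finset.sum_eq_single i]
  · by_cases h : i = j <;> simp [h, eq_comm]
  · intro b _ hb
    simp [Pi.single_apply, hb.symm]
  · simp

lemma rankOne_pair_add (p q : Fin n) {w : ℂ} (hw : conj w * w = 1) (a b : V) :
    rankOne (Pi.single p 1 + w • Pi.single q 1) (b - a) +
      rankOne (Pi.single p 1 - w • Pi.single q 1) (b + a) =
    (2 : ℂ) • (rankOne (Pi.single p 1) b + rankOne (Pi.single q 1) b -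
      (Matrix.single p q (w • a) + Matrix.single q p (conj w • a))) := by
  have hs : ∀ (p q : Fin n) (v : V) (i j : Fin n), Matrix.single p q v i j =
      ((Pi.single p 1 : Fin n → ℂ) i * (Pi.single q 1 : Fin n → ℂ) j) • v := by
    intro p q v i j
    by_cases hi : p = i <;> by_cases hj : q = j <;>
      simp [hi, hj, eq_comm]
  have hd : ∀ p i : Fin n, conj ((Pi.single p 1 : Fin n → ℂ) i) = (Pi.single p 1 : Fin n → ℂ) i := by
    intro p i
    by_cases h : i = p <;> simp [h]
  ext i j
  simp only [Matrix.add_apply, Matrix.sub_apply, Matrix.smul_apply, rankOne_apply, hs,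
    Pi.add_apply, Pi.sub_apply, Pi.smul_apply, map_add, map_sub, smul_eq_mul, map_mul, hd]
  linear_combination (norm := module)
    ((2 * (Pi.single q 1 : Fin n → ℂ) i * (Pi.single q 1 : Fin n → ℂ) j) * hw) • b

lemma eq_zero_of_conjAct_eq_zero {k : ℕ} (hk : 0 < k) {x : Matrix (Fin n) (Fin n) V}
    (hx : ∀ α : Matrix (Fin n) (Fin k) ℂ, conjAct α x = 0) : x = 0 := by
  have h : ∀ u : Fin n → ℂ, ∑ p, ∑ q, (conj (u p) * u q) • x p q = 0 := fun u =>
    congrFun (congrFun (hx (Matrix.of fun p _ => u p)) ⟨0, hk⟩) ⟨0, hk⟩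
  have key : ∀ (p q : Fin n) (w : ℂ), x p p + w • x p q + conj w • x q p +
      (conj w * w) • x q q = 0 := by
    intro p q w
    have := h (Pi.single p 1 + w • Pi.single q 1)
    simpa [Pi.single_apply, add_mul, mul_add, add_smul, Finset.sum_add_distrib, ite_smul,
      apply_ite conj, ← add_assoc, add_right_comm] using this
  have hd : ∀ p, x p p = 0 := fun p => by simpa using key p p 0
  ext p q
  have h1 := key p q 1
  have h2 := key p q Complex.I
  simp only [hd, map_one, Complex.conj_I, smul_zero, add_zero, zero_add, one_smul] at h1 h2
  have h3 : (2 : ℂ) • x p q = 0 := by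
    linear_combination (norm := module) h1 - Complex.I • h2 + Complex.I_mul_I • (x p q - x q p)
  simpa using h3

end ConjAct

section KMin

variable {V : Type u} [AddCommGroup V] [Module ℂ V] [StarAddMonoid V]
  {k : ℕ} {C : Set (Matrix (Fin k) (Fin k) V)} {e : V}

namespace IsKAOU

lemma zero_mem (hC : IsKAOU k C e) : 0 ∈ C := by
  obtain ⟨r, -, hr⟩ := hC.orderUnit 0 (star_zero _)
  simpa using hC.smul_mem 0 le_rfl _ hr

lemma unitMat_mem (hC : IsKAOU k C e) : unitMat k e ∈ C := by
  obtain ⟨r, hr, h⟩ := hC.orderUnit 0 (star_zero _)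
  have := hC.smul_mem r⁻¹ (by positivity) _ h
  have hr' : (r : ℂ) ≠ 0 := by exact_mod_cast hr.ne'
  rwa [sub_zero, smul_smul, Complex.ofReal_inv, inv_mul_cancel₀ hr', one_smul] at this

lemma star_unit (hk : 0 < k) (hC : IsKAOU k C e) : star e = e := by
  have := congrFun (congrFun (hC.herm _ hC.unitMat_mem) ⟨0, hk⟩) ⟨0, hk⟩
  simpa [Matrix.star_apply, unitMat] using this

lemma rankOne_mem (hk : 0 < k) (hC : IsKAOU k C e) {a : V} (ha : unitMat k a ∈ C)
    (u : Fin k → ℂ) : rankOne u a ∈ C := by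
  have h := hC.compat (Matrix.of fun p i => if p = ⟨0, hk⟩ then u i else 0) _ ha
  convert h using 1
  ext i j
  simp [conjAct_apply, unitMat, rankOne_apply, apply_ite conj, ite_smul]

lemma kMinCone_self (hC : IsKAOU k C e) : kMinCone k C k = C := by
  ext x
  refine ⟨fun h => ?_, fun h => ⟨hC.herm x h, fun α => hC.compat α x h⟩⟩
  simpa [conjAct_one] using h.2 1

lemma zero_mem_kMinCone (hC : IsKAOU k C e) (n : ℕ) : 0 ∈ kMinCone k C n :=
  ⟨star_zero _, fun α => by
    have h := conjAct_smul α 0 (0 : Matrix (Fin n) (Fin n) V)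
    rw [zero_smul, zero_smul] at h
    rw [h]; exact hC.zero_mem⟩

lemma exists_unitMat_sub_add_mem (hC : IsKAOU k C e) {a : V} (ha : star a = a) :
    ∃ r : ℝ, 0 < r ∧ unitMat k ((r : ℂ) • e - a) ∈ C ∧ unitMat k ((r : ℂ) • e + a) ∈ C := by
  obtain ⟨r, hr, h1⟩ := hC.orderUnit _ (star_unitMat (n := k) ha)
  obtain ⟨s, hs, h2⟩ := hC.orderUnit _ (star_unitMat (n := k) (show star (-a) = -a by simp [ha]))
  refine ⟨r + s, add_pos hr hs, ?_, ?_⟩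
  · convert hC.add_mem _ h1 _ (hC.smul_mem s hs.le _ hC.unitMat_mem) using 1
    simp only [sub_eq_add_neg, unitMat_add, unitMat_smul, unitMat_neg]
    push_cast
    module
  · convert hC.add_mem _ h2 _ (hC.smul_mem r hr.le _ hC.unitMat_mem) using 1
    simp only [unitMat_add, unitMat_smul, unitMat_neg]
    push_cast
    module

variable [StarModule ℂ V]

lemma kMinCone_isMatrixOrdering (hk : 0 < k) (hC : IsKAOU k C e) :
    IsMatrixOrdering (kMinCone k C) where
  herm _ _ hx := hx.1
  add_mem _ x hx y hy := ⟨by rw [star_add, hx.1, hy.1], fun α => by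
    rw [conjAct_add]; exact hC.add_mem _ (hx.2 α) _ (hy.2 α)⟩
  smul_mem _ r hr x hx := ⟨by rw [star_smul, hx.1]; simp, fun α => by
    rw [conjAct_smul]; exact hC.smul_mem r hr _ (hx.2 α)⟩
  proper _ x hx hx' := eq_zero_of_conjAct_eq_zero hk fun α =>
    hC.proper _ (hx.2 α) (by rw [← conjAct_neg]; exact hx'.2 α)
  compat _ _ α x hx := ⟨by rw [star_conjAct, hx.1], fun β => by
    rw [conjAct_conjAct]; exact hx.2 _⟩

lemma rankOne_mem_kMinCone (hk : 0 < k) (hC : IsKAOU k C e) {n : ℕ} {a : V}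
    (ha : unitMat k a ∈ C) (u : Fin n → ℂ) : rankOne u a ∈ kMinCone k C n := by
  have hs : star a = a := by
    have := congrFun (congrFun (hC.herm _ ha) ⟨0, hk⟩) ⟨0, hk⟩
    simpa [Matrix.star_apply, unitMat] using this
  exact ⟨star_rankOne u hs, fun α => by
    rw [conjAct_rankOne]; exact hC.rankOne_mem hk ha _⟩

lemma sum_mem_kMinCone (hk : 0 < k) (hC : IsKAOU k C e) {n : ℕ} {ι : Type*} (s : Finset ι)
    (f : ι → Matrix (Fin n) (Fin n) V) (hf : ∀ i ∈ s, f i ∈ kMinCone k C n) :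
    ∑ i ∈ s, f i ∈ kMinCone k C n :=
  Finset.sum_induction f (· ∈ kMinCone k C n)
    (fun x y hx hy => (hC.kMinCone_isMatrixOrdering hk).add_mem n x hx y hy)
    (hC.zero_mem_kMinCone n) hf

lemma unitMat_sub_rankOne_mem (hk : 0 < k) (hC : IsKAOU k C e) {n : ℕ} (p : Fin n) :
    unitMat n e - rankOne (Pi.single p 1) e ∈ kMinCone k C n := by
  rw [unitMat_eq_sum_rankOne, ← Finset.sum_erase_eq_sub (Finset.mem_univ p)]
  exact hC.sum_mem_kMinCone hk _ _ fun q _ => hC.rankOne_mem_kMinCone hk hC.unitMat_mem _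

lemma unitMat_mem_kMinCone (hk : 0 < k) (hC : IsKAOU k C e) (n : ℕ) :
    unitMat n e ∈ kMinCone k C n := by
  rw [unitMat_eq_sum_rankOne]
  exact hC.sum_mem_kMinCone hk _ _ fun q _ => hC.rankOne_mem_kMinCone hk hC.unitMat_mem _

/-- `x` is dominated by a positive multiple of `I_n ⊗ e` in the `k`-minimal cone. -/
def Dominated (k : ℕ) (C : Set (Matrix (Fin k) (Fin k) V)) (e : V) {n : ℕ}
    (x : Matrix (Fin n) (Fin n) V) : Prop :=
  ∃ r : ℝ, 0 < r ∧ (r : ℂ) • unitMat n e - x ∈ kMinCone k C n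

lemma Dominated.add (hk : 0 < k) (hC : IsKAOU k C e) {n : ℕ} {x y : Matrix (Fin n) (Fin n) V}
    (hx : Dominated k C e x) (hy : Dominated k C e y) : Dominated k C e (x + y) := by
  obtain ⟨r, hr, hx⟩ := hx
  obtain ⟨s, hs, hy⟩ := hy
  refine ⟨r + s, add_pos hr hs, ?_⟩
  convert (hC.kMinCone_isMatrixOrdering hk).add_mem n _ hx _ hy using 1
  push_cast
  module

lemma Dominated.smul (hk : 0 < k) (hC : IsKAOU k C e) {n : ℕ} {x : Matrix (Fin n) (Fin n) V}
    {t : ℝ} (ht : 0 < t) (hx : Dominated k C e x) : Dominated k C e ((t : ℂ) • x) := by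
  obtain ⟨r, hr, hx⟩ := hx
  refine ⟨t * r, mul_pos ht hr, ?_⟩
  convert (hC.kMinCone_isMatrixOrdering hk).smul_mem n t ht.le _ hx using 1
  push_cast
  module

lemma Dominated.zero (hk : 0 < k) (hC : IsKAOU k C e) {n : ℕ} :
    Dominated k C e (0 : Matrix (Fin n) (Fin n) V) :=
  ⟨1, one_pos, by simpa using hC.unitMat_mem_kMinCone hk n⟩

lemma Dominated.sum (hk : 0 < k) (hC : IsKAOU k C e) {n : ℕ} {ι : Type*} (s : Finset ι)
    (f : ι → Matrix (Fin n) (Fin n) V) (hf : ∀ i ∈ s, Dominated k C e (f i)) :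
    Dominated k C e (∑ i ∈ s, f i) :=
  Finset.sum_induction f (Dominated k C e) (fun _ _ hx hy => hx.add hk hC hy)
    (Dominated.zero hk hC) hf

lemma dominated_single_add_single (hk : 0 < k) (hC : IsKAOU k C e) {n : ℕ} (p q : Fin n) {w : ℂ}
    (hw : conj w * w = 1) {a : V} (ha : star a = a) :
    Dominated k C e (Matrix.single p q (w • a) + Matrix.single q p (conj w • a)) := by
  have hM := hC.kMinCone_isMatrixOrdering hk
  obtain ⟨r, hr, h1, h2⟩ := hC.exists_unitMat_sub_add_mem ha
  refine ⟨2 * r, by positivity, ?_⟩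
  have h3 := hM.smul_mem n 2⁻¹ (by positivity) _ <| hM.add_mem n _
    (hC.rankOne_mem_kMinCone hk h1 (Pi.single p 1 + w • Pi.single q 1)) _
    (hC.rankOne_mem_kMinCone hk h2 (Pi.single p 1 - w • Pi.single q 1))
  rw [rankOne_pair_add p q hw] at h3
  have h4 := hM.smul_mem n r hr.le _ <| hM.add_mem n _ (hC.unitMat_sub_rankOne_mem hk p) _
    (hC.unitMat_sub_rankOne_mem hk q)
  convert hM.add_mem n _ h3 _ h4 using 1
  have hr' : ∀ u : Fin n → ℂ, rankOne u ((r : ℂ) • e) = (r : ℂ) • rankOne u e := fun u => by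
    ext i j
    simp [rankOne_apply, smul_comm (r : ℂ)]
  simp only [hr']
  push_cast
  module

lemma dominated_single_add_star (hk : 0 < k) (hC : IsKAOU k C e) {n : ℕ} (p q : Fin n) (v : V) :
    Dominated k C e (Matrix.single p q v + Matrix.single q p (star v)) := by
  have h1 := hC.dominated_single_add_single hk p q (w := 1) (by simp)
    (a := (realPart v : V)) (realPart v).2
  have h2 := hC.dominated_single_add_single hk p q (w := Complex.I) (by simp)
    (a := (imaginaryPart v : V)) (imaginaryPart v).2
  convert h1.add hk hC h2 using 1
  have hv := realPart_add_I_smul_imaginaryPart v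
  have hv' : star v = (realPart v : V) + conj Complex.I • (imaginaryPart v : V) := by
    conv_lhs => rw [← hv]
    rw [star_add, star_smul, (realPart v).2, (imaginaryPart v).2]
    rfl
  rw [hv']
  nth_rewrite 1 [← hv]
  simp only [Matrix.single_add, one_smul, map_one]
  abel

lemma dominated_of_star_eq (hk : 0 < k) (hC : IsKAOU k C e) {n : ℕ}
    {x : Matrix (Fin n) (Fin n) V} (hx : star x = x) : Dominated k C e x := by
  have h : Dominated k C e (∑ p, ∑ q,
      (Matrix.single p q (x p q) + Matrix.single q p (star (x p q)))) :=
    Dominated.sum hk hC _ _ fun p _ => Dominated.sum hk hC _ _ fun q _ =>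
      hC.dominated_single_add_star hk p q _
  have hsum : ∑ p, ∑ q, (Matrix.single p q (x p q) + Matrix.single q p (star (x p q))) =
      x + star x := by
    simp only [Finset.sum_add_distrib]
    rw [← Matrix.matrix_eq_sum_single, Finset.sum_comm]
    congr 1
    exact (Matrix.matrix_eq_sum_single (star x)).symm
  rw [hsum, hx] at h
  convert h.smul hk hC (t := 2⁻¹) (by positivity) using 1
  push_cast
  module

lemma kMinCone_arch (hk : 0 < k) (hC : IsKAOU k C e) {n : ℕ} {x : Matrix (Fin n) (Fin n) V}
    (hx : ∀ r : ℝ, 0 < r → x + (r : ℂ) • unitMat n e ∈ kMinCone k C n) : x ∈ kMinCone k C n := by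
  have he := hC.star_unit hk
  refine ⟨?_, fun α => hC.arch _ fun r hr => ?_⟩
  · have h := (hx 1 one_pos).1
    rw [star_add, star_smul, star_unitMat he] at h
    simpa using h
  · obtain ⟨s, hs, h⟩ := hC.orderUnit (conjAct α (unitMat n e))
      (by rw [star_conjAct, star_unitMat he])
    have h1 := (hx (r / s) (by positivity)).2 α
    rw [conjAct_add, conjAct_smul] at h1
    have h2 := hC.smul_mem (r / s) (by positivity) _ h
    convert hC.add_mem _ h1 _ h2 using 1
    have hs' : ((r / s : ℝ) : ℂ) * s = r := by
      rw [← Complex.ofReal_mul, div_mul_cancel₀ r hs.ne']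
    rw [smul_sub, smul_smul, hs']
    abel

end IsKAOU

end KMin

/-- For a `k`-AOU space `(V, C, e)` we have `C_k^{k-min} = C` and
`(V, {C_n^{k-min}}, e)` is an operator system. -/
theorem stmt_1 {V : Type u} [AddCommGroup V] [Module ℂ V] [StarAddMonoid V] [StarModule ℂ V]
    (k : ℕ) (hk : 0 < k) (C : Set (Matrix (Fin k) (Fin k) V)) (e : V)
    (hC : IsKAOU k C e) :
    kMinCone k C k = C ∧ IsOperatorSystem (kMinCone k C) e := by
  exact ⟨hC.kMinCone_self,
    { hC.kMinCone_isMatrixOrdering hk with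
      orderUnit := fun _ _ hx => hC.dominated_of_star_eq hk hx
      arch := fun _ _ hx => hC.kMinCone_arch hk hx }⟩
end
end

section
/- Let k ∈ ℕ, let (V, C, e) be a k-AOU space, and let {𝒞_n} be an extension of C (a matrix ordering on V with 𝒞_k = C making (V, {𝒞_n}, e) an operator system). Then 𝒞_n ⊆ C_n^{k-min} for every n ∈ ℕ, and 𝒞_n = C_n^{k-min} for every n ∈ {1, 2, …, k}. -/
open scoped ComplexConjugate ComplexOrder

noncomputable section

universe u v

/-- Conjugating by the inclusion `ℂ ^ n → ℂ ^ k` and then compressing back to the corresponding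
corner recovers the original matrix. -/
theorem conjAct_conjAct_of_injective {V : Type u} [AddCommGroup V] [Module ℂ V] {n k : ℕ}
    {f : Fin n → Fin k} (hf : Function.Injective f) (x : Matrix (Fin n) (Fin n) V) :
    conjAct (Matrix.of fun i p => if i = f p then (1 : ℂ) else 0)
      (conjAct (Matrix.of fun p i => if i = f p then (1 : ℂ) else 0) x) = x := by
  ext i j
  simp [conjAct, hf.eq_iff, apply_ite, ite_smul]

/-- If `{𝒞_n}` is an extension of the `k`-AOU space `(V, C, e)`, then
`𝒞_n ⊆ C_n^{k-min}` for every `n`, with equality for `n ∈ {1, …, k}`. -/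
theorem stmt_2 {V : Type u} [AddCommGroup V] [Module ℂ V] [StarAddMonoid V] [StarModule ℂ V]
    (k : ℕ) (hk : 0 < k) (C : Set (Matrix (Fin k) (Fin k) V)) (e : V)
    (hC : IsKAOU k C e) (𝒞 : ∀ n : ℕ, Set (Matrix (Fin n) (Fin n) V))
    (h𝒞 : IsExtension k C e 𝒞) :
    (∀ n : ℕ, 𝒞 n ⊆ kMinCone k C n) ∧
      (∀ n : ℕ, 1 ≤ n → n ≤ k → 𝒞 n = kMinCone k C n) := by
  obtain ⟨hS, rfl⟩ := h𝒞
  have hsub : ∀ n : ℕ, 𝒞 n ⊆ kMinCone k (𝒞 k) n := fun n x hx =>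
    ⟨hS.herm n x hx, fun α => hS.compat n k α x hx⟩
  refine ⟨hsub, fun n _ hnk => (hsub n).antisymm fun x hx => ?_⟩
  rw [← conjAct_conjAct_of_injective (Fin.castLE_injective hnk) x]
  exact hS.compat k n _ _ (hx.2 _)
end
end

section
/- Let k ∈ ℕ, let (V, C, e) and (W, D, f) be k-AOU spaces, and let i: V → W be a k-order embedding (i is injective, i_k(C) ⊆ D, and i_k(x) ∈ D implies x ∈ C). Then i: V_{k-min} → W_{k-min} is a complete order embedding: for every n ∈ ℕ and hermitian x ∈ M_n(V), x ∈ C_n^{k-min} if and only if i_n(x) ∈ D_n^{k-min}. -/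
open scoped ComplexConjugate ComplexOrder

noncomputable section

universe u v

theorem map_conjAct {V : Type u} {W : Type v} [AddCommGroup V] [Module ℂ V]
    [AddCommGroup W] [Module ℂ W] (i : V →ₗ[ℂ] W) {n m : ℕ}
    (α : Matrix (Fin n) (Fin m) ℂ) (x : Matrix (Fin n) (Fin n) V) :
    (conjAct α x).map i = conjAct α (x.map i) := by
  ext p q
  simp [conjAct]

/-- A linear map sending hermitian elements to hermitian elements commutes with the involution. -/
theorem map_star_of_map_hermitian {V : Type u} {W : Type v}
    [AddCommGroup V] [Module ℂ V] [StarAddMonoid V] [StarModule ℂ V]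
    [AddCommGroup W] [Module ℂ W] [StarAddMonoid W] [StarModule ℂ W]
    (i : V →ₗ[ℂ] W) (h : ∀ v, star v = v → star (i v) = i v) (v : V) :
    i (star v) = star (i v) := by
  have hre := (realPart v).2.star_eq
  have him := (imaginaryPart v).2.star_eq
  conv_lhs => rw [← realPart_add_I_smul_imaginaryPart v]
  conv_rhs => rw [← realPart_add_I_smul_imaginaryPart v]
  rw [star_add, star_smul, map_add, map_smul, map_add, map_smul, star_add, star_smul,
    hre, him, h _ hre, h _ him]

/-- A `k`-positive linear map between `k`-AOU spaces sends hermitian elements to hermitian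
elements. -/
theorem IsKAOU.map_hermitian {V : Type u} {W : Type v}
    [AddCommGroup V] [Module ℂ V] [StarAddMonoid V] [StarModule ℂ V]
    [AddCommGroup W] [Module ℂ W] [StarAddMonoid W] [StarModule ℂ W]
    {k : ℕ} (hk : 0 < k)
    {C : Set (Matrix (Fin k) (Fin k) V)} {e : V} (hC : IsKAOU k C e)
    {D : Set (Matrix (Fin k) (Fin k) W)} {f : W} (hD : IsKAOU k D f)
    (i : V →ₗ[ℂ] W) (hpos : ∀ x ∈ C, x.map ⇑i ∈ D) (v : V) (hv : star v = v) :
    star (i v) = i v := by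
  have key (w : V) (hw : star w = w) :
      ∃ r : ℝ, 0 < r ∧ star (i ((r : ℂ) • e - w)) = i ((r : ℂ) • e - w) := by
    obtain ⟨r, hr, hmem⟩ := hC.orderUnit (unitMat k w) (by
      ext p q
      by_cases hpq : p = q
      · subst hpq
        simp [Matrix.star_apply, unitMat, hw]
      · simp [Matrix.star_apply, unitMat, hpq, Ne.symm hpq])
    have := congrFun (congrFun (hD.herm _ (hpos _ hmem)) ⟨0, hk⟩) ⟨0, hk⟩
    exact ⟨r, hr, by simpa [Matrix.star_apply, unitMat] using this⟩
  obtain ⟨s, hs, hse⟩ := key 0 (star_zero V)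
  have hie : star (i e) = i e := by
    have hs0 : (s : ℂ) ≠ 0 := by exact_mod_cast hs.ne'
    rw [sub_zero, map_smul, star_smul] at hse
    exact smul_right_injective W hs0 (by simpa using hse)
  obtain ⟨r, -, hr⟩ := key v hv
  simpa [star_smul, hie] using hr

/-- A `k`-order embedding `i : (V, C, e) → (W, D, f)` of `k`-AOU spaces induces
a complete order embedding `V_{k-min} → W_{k-min}`. -/
theorem stmt_4 {V : Type u} {W : Type v}
    [AddCommGroup V] [Module ℂ V] [StarAddMonoid V] [StarModule ℂ V]
    [AddCommGroup W] [Module ℂ W] [StarAddMonoid W] [StarModule ℂ W]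
    (k : ℕ) (hk : 0 < k)
    (C : Set (Matrix (Fin k) (Fin k) V)) (e : V) (hC : IsKAOU k C e)
    (D : Set (Matrix (Fin k) (Fin k) W)) (f : W) (hD : IsKAOU k D f)
    (i : V →ₗ[ℂ] W) (hinj : Function.Injective i)
    (hpos : ∀ x ∈ C, x.map ⇑i ∈ D)
    (hrefl : ∀ x : Matrix (Fin k) (Fin k) V, x.map ⇑i ∈ D → x ∈ C) :
    ∀ n : ℕ, ∀ x : Matrix (Fin n) (Fin n) V, star x = x →
      (x ∈ kMinCone k C n ↔ x.map ⇑i ∈ kMinCone k D n) := by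
  intro n x hx
  have hstar := map_star_of_map_hermitian i (hC.map_hermitian hk hD i hpos)
  have hxi : star (x.map ⇑i) = x.map ⇑i := by
    ext p q
    rw [Matrix.star_apply, Matrix.map_apply, Matrix.map_apply, ← hstar, ← Matrix.star_apply, hx]
  constructor
  · rintro ⟨-, h⟩
    exact ⟨hxi, fun α => map_conjAct i α x ▸ hpos _ (h α)⟩
  · rintro ⟨-, h⟩
    exact ⟨hx, fun α => hrefl _ (map_conjAct i α x ▸ h α)⟩
end
end

section
/- Let k ∈ ℕ, let (V, C, e) be a k-AOU space, and let {𝒞_n} be any extension of C. Then for every hermitian x ∈ V: x ∈ 𝒞_1 if and only if I_k ⊗ x ∈ C. -/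
open scoped ComplexConjugate ComplexOrder

noncomputable section

universe u v

/-- A column of the identity compresses `I_k ⊗ x` to the `1 × 1` matrix `x`. -/
lemma conjAct_column_unitMat {V : Type u} [AddCommGroup V] [Module ℂ V] {k : ℕ} (i : Fin k)
    (x : V) :
    conjAct (Matrix.of fun p _ => if p = i then 1 else 0 : Matrix (Fin k) (Fin 1) ℂ)
      (unitMat k x) = Matrix.of fun _ _ => x := by
  ext a b
  simp [conjAct, unitMat, ite_smul]

/-- `I_k ⊗ x` is the sum of the conjugates of `x` by the rows of the identity. -/
lemma sum_conjAct_row {V : Type u} [AddCommGroup V] [Module ℂ V] (k : ℕ) (x : V) :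
    ∑ i : Fin k, conjAct (Matrix.of fun _ q => if q = i then 1 else 0 : Matrix (Fin 1) (Fin k) ℂ)
      (Matrix.of fun _ _ => x) = unitMat k x := by
  ext a b
  simp [conjAct, unitMat, Matrix.sum_apply, ite_smul, eq_comm]

/-- For any extension `{𝒞_n}` of a `k`-AOU space `(V, C, e)` and hermitian
`x ∈ V`: `x ∈ 𝒞_1` if and only if `I_k ⊗ x ∈ C`. -/
theorem stmt_6 {V : Type u} [AddCommGroup V] [Module ℂ V] [StarAddMonoid V] [StarModule ℂ V]
    (k : ℕ) (hk : 0 < k) (C : Set (Matrix (Fin k) (Fin k) V)) (e : V)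
    (hC : IsKAOU k C e) (𝒞 : ∀ n : ℕ, Set (Matrix (Fin n) (Fin n) V))
    (h𝒞 : IsExtension k C e 𝒞) (x : V) (hx : star x = x) :
    (Matrix.of fun _ _ => x : Matrix (Fin 1) (Fin 1) V) ∈ 𝒞 1 ↔ unitMat k x ∈ C := by
  obtain ⟨hS, rfl⟩ := h𝒞
  constructor
  · intro h
    rw [← sum_conjAct_row]
    refine Finset.sum_induction _ (· ∈ 𝒞 k) (fun a b ha hb => hS.add_mem k a ha b hb) ?_
      fun i _ => hS.compat 1 k _ _ h
    obtain ⟨r, -, hr⟩ := hS.orderUnit k 0 (star_zero _)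
    simpa using hS.smul_mem k 0 le_rfl _ hr
  · intro h
    rw [← conjAct_column_unitMat (⟨0, hk⟩ : Fin k) x]
    exact hS.compat k 1 _ _ h
end
end

section
/- Let (W, D, e) be an AOU space and let V ⊆ W be a linear subspace with e ∈ V and V* = V, equipped with the cone C = D ∩ V. If φ: V → ℂ is a pure state on (V, C, e), then there exists a pure state φ̃: W → ℂ on (W, D, e) with φ̃|_V = φ. -/
open scoped ComplexConjugate ComplexOrder

noncomputable section

universe u v

/-- A state on the triple `(X, D, e)`: a linear functional which is `1` at the unit and
nonnegative on the cone. -/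
def IsStateOn {X : Type v} [AddCommGroup X] [Module ℂ X]
    (D : Set X) (e : X) (φ : X →ₗ[ℂ] ℂ) : Prop :=
  φ e = 1 ∧ ∀ x ∈ D, 0 ≤ φ x

/-- A pure state on the triple `(X, D, e)`: an extreme point of the set of states. -/
def IsPureStateOn {X : Type v} [AddCommGroup X] [Module ℂ X]
    (D : Set X) (e : X) (φ : X →ₗ[ℂ] ℂ) : Prop :=
  IsStateOn D e φ ∧
    ∀ ψ₁ ψ₂ : X →ₗ[ℂ] ℂ, IsStateOn D e ψ₁ → IsStateOn D e ψ₂ →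
      ∀ t : ℝ, 0 < t → t < 1 → φ = (t : ℂ) • ψ₁ + ((1 - t : ℝ) : ℂ) • ψ₂ →
        ψ₁ = φ ∧ ψ₂ = φ

/-- `(W, D, e)` is an Archimedean order unit space. -/
structure IsAOU {W : Type u} [AddCommGroup W] [Module ℂ W] [StarAddMonoid W] [StarModule ℂ W]
    (D : Set W) (e : W) : Prop where
  herm : ∀ x ∈ D, star x = x
  add_mem : ∀ x ∈ D, ∀ y ∈ D, x + y ∈ D
  smul_mem : ∀ r : ℝ, 0 ≤ r → ∀ x ∈ D, (r : ℂ) • x ∈ D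
  proper : ∀ x ∈ D, -x ∈ D → x = 0
  orderUnit : ∀ x : W, star x = x → ∃ r : ℝ, 0 < r ∧ (r : ℂ) • e - x ∈ D
  arch : ∀ x : W, (∀ r : ℝ, 0 < r → x + (r : ℂ) • e ∈ D) → x ∈ D

theorem IsStateOn.im_eq_zero_and_re_le {X : Type v} [AddCommGroup X] [Module ℂ X]
    {D : Set X} {e : X} {f : X →ₗ[ℂ] ℂ} (hf : IsStateOn D e f) {x : X} {r : ℝ}
    (hx : (r : ℂ) • e - x ∈ D) : (f x).im = 0 ∧ (f x).re ≤ r := by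
  have h := hf.2 _ hx
  rw [map_sub, map_smul, hf.1, Complex.nonneg_iff] at h
  simp at h
  exact ⟨by linarith [h.2], h.1⟩

theorem star_add_star_self {W : Type u} [AddCommGroup W] [StarAddMonoid W] (x : W) :
    star (x + star x) = x + star x := by
  rw [star_add, star_star, add_comm]

section AOU

variable {W : Type u} [AddCommGroup W] [Module ℂ W] [StarAddMonoid W] [StarModule ℂ W]
  {D : Set W} {e : W}

theorem star_I_smul_sub_star_self (x : W) :
    star (Complex.I • (x - star x)) = Complex.I • (x - star x) := by
  rw [star_smul, star_sub, star_star, Complex.star_def, Complex.conj_I, neg_smul, ← smul_neg,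
    neg_sub]

theorem IsAOU.zero_mem (hW : IsAOU D e) : (0 : W) ∈ D := by
  obtain ⟨r, -, hr⟩ := hW.orderUnit 0 (star_zero W)
  simpa using hW.smul_mem 0 le_rfl _ hr

theorem IsAOU.star_unit (hW : IsAOU D e) : star e = e := by
  obtain ⟨r, hr0, hr⟩ := hW.orderUnit 0 (star_zero W)
  have h := hW.smul_mem r⁻¹ (inv_nonneg.2 hr0.le) _ hr
  rw [sub_zero, smul_smul, ← Complex.ofReal_mul, inv_mul_cancel₀ hr0.ne', Complex.ofReal_one,
    one_smul] at h
  exact hW.herm _ h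

/-- On a selfadjoint unital subspace, states are hermitian. -/
theorem IsAOU.state_star (hW : IsAOU D e) {V : Submodule ℂ W} (he : e ∈ V)
    (hstar : ∀ v ∈ V, star v ∈ V) {f : V →ₗ[ℂ] ℂ}
    (hf : IsStateOn {v : V | (v : W) ∈ D} ⟨e, he⟩ f) (x : V) :
    f ⟨star (x : W), hstar _ x.2⟩ = conj (f x) := by
  obtain ⟨r, -, hr⟩ := hW.orderUnit _ (star_add_star_self (x : W))
  obtain ⟨s, -, hs⟩ := hW.orderUnit _ (star_I_smul_sub_star_self (x : W))
  have h₁ := (hf.im_eq_zero_and_re_le (x := x + ⟨star (x : W), hstar _ x.2⟩) (r := r) hr).1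
  have h₂ := (hf.im_eq_zero_and_re_le
    (x := Complex.I • (x - ⟨star (x : W), hstar _ x.2⟩)) (r := s) hs).1
  simp at h₁ h₂
  apply Complex.ext
  · simp; linarith
  · simp; linarith

theorem IsAOU.exists_norm_state_le_of_star_eq (hW : IsAOU D e) {x : W} (hx : star x = x) :
    ∃ r : ℝ, ∀ f : W →ₗ[ℂ] ℂ, IsStateOn D e f → ‖f x‖ ≤ r := by
  obtain ⟨r, -, hr⟩ := hW.orderUnit x hx
  obtain ⟨s, -, hs⟩ := hW.orderUnit (-x) (by rw [star_neg, hx])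
  refine ⟨max r s, fun f hf => ?_⟩
  have h₁ := hf.im_eq_zero_and_re_le hr
  have h₂ := (hf.im_eq_zero_and_re_le hs).2
  rw [map_neg, Complex.neg_re] at h₂
  have h : f x = ((f x).re : ℂ) := Complex.ext rfl h₁.1
  rw [h, Complex.norm_real, Real.norm_eq_abs]
  exact abs_le'.2 ⟨h₁.2.trans (le_max_left _ _), h₂.trans (le_max_right _ _)⟩

theorem IsAOU.exists_norm_state_le (hW : IsAOU D e) (x : W) :
    ∃ r : ℝ, ∀ f : W →ₗ[ℂ] ℂ, IsStateOn D e f → ‖f x‖ ≤ r := by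
  obtain ⟨r, hr⟩ := hW.exists_norm_state_le_of_star_eq (star_add_star_self x)
  obtain ⟨s, hs⟩ := hW.exists_norm_state_le_of_star_eq (star_I_smul_sub_star_self x)
  refine ⟨(r + s) / 2, fun f hf => ?_⟩
  have h₁ := hr f hf
  have h₂ := hs f hf
  rw [map_smul, norm_smul, Complex.norm_I, one_mul, map_sub] at h₂
  rw [map_add] at h₁
  have h := norm_add_le (f x + f (star x)) (f x - f (star x))
  have h' : f x + f (star x) + (f x - f (star x)) = 2 * f x := by ring
  rw [h', norm_mul, Complex.norm_ofNat] at h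
  linarith

/-- The real cone of elements whose real part lies in the cone of an AOU space. -/
def IsAOU.reCone (hW : IsAOU D e) : PointedCone ℝ W where
  carrier := {x | x + star x ∈ D}
  add_mem' {x y} hx hy := by
    have h := hW.add_mem _ hx _ hy
    rwa [add_add_add_comm, ← star_add] at h
  zero_mem' := by simpa using hW.zero_mem
  smul_mem' c x hx := by
    have h := hW.smul_mem c c.2 _ hx
    have hc : star ((c : ℂ) • x) = (c : ℂ) • star x := by
      rw [star_smul, Complex.star_def, Complex.conj_ofReal]
    rw [smul_add, ← hc] at h
    exact h

theorem IsAOU.mem_reCone (hW : IsAOU D e) {x : W} : x ∈ hW.reCone ↔ x + star x ∈ D := Iff.rfl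

theorem IsAOU.exists_state_extension (hW : IsAOU D e) {V : Submodule ℂ W} (he : e ∈ V)
    (hstar : ∀ v ∈ V, star v ∈ V) {φ : V →ₗ[ℂ] ℂ}
    (hφ : IsStateOn {v : V | (v : W) ∈ D} ⟨e, he⟩ φ) :
    ∃ f : W →ₗ[ℂ] ℂ, IsStateOn D e f ∧ f ∘ₗ V.subtype = φ := by
  obtain ⟨g, hgφ, hg⟩ := riesz_extension hW.reCone
    ⟨V.restrictScalars ℝ, Complex.reLm ∘ₗ φ.restrictScalars ℝ⟩
    (fun (x : V) hx => by
      have h := hφ.2 (x + ⟨star (x : W), hstar _ x.2⟩ : V) hx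
      rw [map_add, hW.state_star he hstar hφ, Complex.add_conj, Complex.zero_le_real] at h
      change 0 ≤ (φ x).re
      linarith)
    (fun y => by
      obtain ⟨r, -, hr⟩ := hW.orderUnit (-(y + star y)) (by rw [star_neg, star_add_star_self])
      refine ⟨⟨((r / 2 : ℝ) : ℂ) • e, V.smul_mem _ he⟩, hW.mem_reCone.2 ?_⟩
      convert hr using 1
      rw [star_add, star_smul, hW.star_unit, Complex.star_def, Complex.conj_ofReal,
        add_add_add_comm, ← add_smul, ← Complex.ofReal_add, add_halves, sub_neg_eq_add])
  have hgV (x : V) : g x = (φ x).re := hgφ x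
  have hext (x : V) : Module.Dual.extendRCLike (𝕜 := ℂ) g (x : W) = φ x := by
    rw [Module.Dual.extendRCLike_apply]
    have h := hgV (Complex.I • x)
    rw [map_smul, V.coe_smul] at h
    apply Complex.ext <;> simp [hgV, h]
  refine ⟨Module.Dual.extendRCLike (𝕜 := ℂ) g, ⟨(hext ⟨e, he⟩).trans hφ.1, fun x hx => ?_⟩,
    LinearMap.ext hext⟩
  have hsx := hW.herm x hx
  have h₀ : 0 ≤ g x := hg _ (hW.mem_reCone.2 (by rw [hsx]; exact hW.add_mem _ hx _ hx))
  have hI : star (Complex.I • x) = -(Complex.I • x) := by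
    rw [star_smul, hsx, Complex.star_def, Complex.conj_I, neg_smul]
  have h₁ : 0 ≤ g (Complex.I • x) := hg _ (hW.mem_reCone.2 (by
    rw [hI, add_neg_cancel]; exact hW.zero_mem))
  have h₂ : 0 ≤ g (-(Complex.I • x)) := hg _ (hW.mem_reCone.2 (by
    rw [star_neg, hI, neg_neg, neg_add_cancel]; exact hW.zero_mem))
  rw [map_neg] at h₂
  have h₃ : g (Complex.I • x) = 0 := by linarith
  rw [Module.Dual.extendRCLike_apply]
  simpa [h₃] using h₀

/-- The states extending a given functional are compact for pointwise convergence. -/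
theorem IsAOU.isCompact_state_extensions (hW : IsAOU D e) {V : Submodule ℂ W}
    (φ : V →ₗ[ℂ] ℂ) :
    IsCompact ((fun (f : W →ₗ[ℂ] ℂ) (x : W) => f x) ''
      {f | IsStateOn D e f ∧ f ∘ₗ V.subtype = φ}) := by
  choose r hr using hW.exists_norm_state_le
  refine (isCompact_univ_pi fun x => isCompact_closedBall (0 : ℂ) (r x)).of_isClosed_subset ?_ ?_
  · have h : ((fun (f : W →ₗ[ℂ] ℂ) (x : W) => f x) ''
        {f | IsStateOn D e f ∧ f ∘ₗ V.subtype = φ}) =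
        Set.range (fun (f : W →ₗ[ℂ] ℂ) (x : W) => f x) ∩
          (({F | F e = 1} ∩ ⋂ x ∈ D, {F | 0 ≤ F x}) ∩ ⋂ x : V, {F | F x = φ x}) := by
      ext F
      simp only [Set.mem_image, Set.mem_inter_iff, Set.mem_range, Set.mem_iInter,
        Set.mem_ofPred_eq]
      constructor
      · rintro ⟨f, ⟨hf, hfφ⟩, rfl⟩
        exact ⟨⟨f, rfl⟩, hf, fun x => LinearMap.congr_fun hfφ x⟩
      · rintro ⟨⟨f, rfl⟩, hf, hfφ⟩
        exact ⟨f, ⟨hf, LinearMap.ext hfφ⟩, rfl⟩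
    rw [h]
    refine (LinearMap.isClosed_range_coe W ℂ (RingHom.id ℂ)).inter
      (((isClosed_eq (continuous_apply e) continuous_const).inter ?_).inter ?_)
    · exact isClosed_biInter fun x _ => isClosed_le continuous_const (continuous_apply x)
    · exact isClosed_iInter fun x => isClosed_eq (continuous_apply (x : W)) continuous_const
  · rintro _ ⟨f, ⟨hf, -⟩, rfl⟩ x -
    exact mem_closedBall_zero_iff.2 (hr x f hf)

end AOU

/-- A pure state on a unital selfadjoint subspace `V` of an AOU space
`(W, D, e)` (with the cone `D ∩ V`) extends to a pure state on `(W, D, e)`. -/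
theorem stmt_14 {W : Type u} [AddCommGroup W] [Module ℂ W] [StarAddMonoid W] [StarModule ℂ W]
    (D : Set W) (e : W) (hW : IsAOU D e)
    (V : Submodule ℂ W) (he : e ∈ V) (hstar : ∀ v ∈ V, star v ∈ V)
    (φ : ↥V →ₗ[ℂ] ℂ)
    (hφ : IsPureStateOn {v : ↥V | (v : W) ∈ D} (⟨e, he⟩ : ↥V) φ) :
    ∃ φt : W →ₗ[ℂ] ℂ, IsPureStateOn D e φt ∧ φt ∘ₗ V.subtype = φ := by
  obtain ⟨f₀, hf₀⟩ := hW.exists_state_extension he hstar hφ.1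
  obtain ⟨F, hext⟩ :=
    (hW.isCompact_state_extensions φ).extremePoints_nonempty ⟨_, f₀, hf₀, rfl⟩
  obtain ⟨f, hf, rfl⟩ := hext.1
  refine ⟨f, ⟨hf.1, fun ψ₁ ψ₂ h₁ h₂ t ht₀ ht₁ hft => ?_⟩, hf.2⟩
  obtain ⟨hr₁, hr₂⟩ := hφ.2 (ψ₁ ∘ₗ V.subtype) (ψ₂ ∘ₗ V.subtype)
    ⟨h₁.1, fun x hx => h₁.2 x hx⟩ ⟨h₂.1, fun x hx => h₂.2 x hx⟩ t ht₀ ht₁ (by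
      rw [← hf.2, hft, LinearMap.add_comp, LinearMap.smul_comp, LinearMap.smul_comp])
  have hseg : (fun x => f x) ∈ openSegment ℝ (fun x => ψ₁ x) (fun x => ψ₂ x) := by
    refine ⟨t, 1 - t, ht₀, sub_pos.2 ht₁, add_sub_cancel _ _, ?_⟩
    funext x
    simp [hft]
  have h := (mem_extremePoints.1 hext).2 _ ⟨ψ₁, ⟨h₁, hr₁⟩, rfl⟩ _
    ⟨ψ₂, ⟨h₂, hr₂⟩, rfl⟩ hseg
  exact ⟨LinearMap.ext (congr_fun h.1), LinearMap.ext (congr_fun h.2)⟩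
end
end

section
/- Let X be a compact Hausdorff space and let A be a unital C*-algebra. If ρ: C(X, A) → ℂ is a pure state on the C*-algebra C(X, A) of continuous A-valued functions on X, then there exist a pure state φ: A → ℂ and a point x₀ ∈ X such that ρ(f) = φ(f(x₀)) for all f ∈ C(X, A). -/
open scoped ComplexConjugate ComplexOrder

noncomputable section

universe u v

/-- A state on a unital complex `*`-algebra `B`: a linear functional with `ρ(1) = 1` and
`ρ(b* b) ≥ 0` for all `b`. -/
def IsStateCstar {B : Type v} [Ring B] [StarRing B] [Algebra ℂ B]
    (ρ : B →ₗ[ℂ] ℂ) : Prop :=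
  ρ 1 = 1 ∧ ∀ b : B, 0 ≤ ρ (star b * b)

/-- A pure state on a unital complex `*`-algebra `B`: an extreme point of the set of
states. -/
def IsPureStateCstar {B : Type v} [Ring B] [StarRing B] [Algebra ℂ B]
    (ρ : B →ₗ[ℂ] ℂ) : Prop :=
  IsStateCstar ρ ∧
    ∀ ψ₁ ψ₂ : B →ₗ[ℂ] ℂ, IsStateCstar ψ₁ → IsStateCstar ψ₂ →
      ∀ t : ℝ, 0 < t → t < 1 → ρ = (t : ℂ) • ψ₁ + ((1 - t : ℝ) : ℂ) • ψ₂ →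
        ψ₁ = ρ ∧ ψ₂ = ρ

section ScalarFunctions

variable {X : Type u} [TopologicalSpace X] {A : Type v} [NormedRing A] [NormedAlgebra ℂ A]

theorem scalar_smul_add (h : C(X, ℂ)) (b c : C(X, A)) : h • (b + c) = h • b + h • c :=
  ContinuousMap.ext fun x => smul_add (h x) (b x) (c x)

theorem scalar_add_smul (h k : C(X, ℂ)) (b : C(X, A)) : (h + k) • b = h • b + k • b :=
  ContinuousMap.ext fun x => add_smul (h x) (k x) (b x)

theorem scalar_sub_smul (h k : C(X, ℂ)) (b : C(X, A)) : (h - k) • b = h • b - k • b :=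
  ContinuousMap.ext fun x => sub_smul (h x) (k x) (b x)

theorem scalar_mul_smul (h k : C(X, ℂ)) (b : C(X, A)) : (h * k) • b = h • k • b :=
  ContinuousMap.ext fun x => mul_smul (h x) (k x) (b x)

theorem scalar_one_smul (b : C(X, A)) : (1 : C(X, ℂ)) • b = b :=
  ContinuousMap.ext fun x => one_smul ℂ (b x)

theorem scalar_smul_smul (c : ℂ) (h : C(X, ℂ)) (b : C(X, A)) : (c • h) • b = c • h • b :=
  ContinuousMap.ext fun x => smul_assoc c (h x) (b x)

end ScalarFunctions

theorem IsStateCstar.apply_smul_star_mul_self_nonneg {X : Type u} [TopologicalSpace X]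
    {A : Type v} [NormedRing A] [StarRing A] [CStarRing A] [NormedAlgebra ℂ A] [StarModule ℂ A]
    {ρ : C(X, A) →ₗ[ℂ] ℂ} (hρ : IsStateCstar ρ) {h : C(X, ℂ)} (hh : ∀ x, 0 ≤ h x)
    (b : C(X, A)) : 0 ≤ ρ (h • (star b * b)) := by
  let s : C(X, ℂ) := ⟨fun x => ((√(h x).re : ℝ) : ℂ), by fun_prop⟩
  have key : h • (star b * b) = star (s • b) * (s • b) := by
    ext x
    have h2 : ((√(h x).re : ℝ) : ℂ) * ((√(h x).re : ℝ) : ℂ) = h x := by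
      rw [← Complex.ofReal_mul, Real.mul_self_sqrt (Complex.nonneg_iff.1 (hh x)).1]
      exact (Complex.eq_re_of_ofReal_le (hh x)).symm
    change h x • (star (b x) * b x) = star ((s x) • b x) * ((s x) • b x)
    rw [star_smul, smul_mul_smul_comm, ← h2]
    simp [s]
  rw [key]
  exact hρ.2 _

/-- The functional `b ↦ ρ (h • b)` on `C(X, A)`, for a scalar function `h`. -/
def smulFunctional {X : Type u} [TopologicalSpace X] {A : Type v} [NormedRing A]
    [NormedAlgebra ℂ A] (ρ : C(X, A) →ₗ[ℂ] ℂ) (h : C(X, ℂ)) : C(X, A) →ₗ[ℂ] ℂ where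
  toFun b := ρ (h • b)
  map_add' b c := by rw [scalar_smul_add, map_add]
  map_smul' c b := by
    rw [RingHom.id_apply, ← ρ.map_smul]
    congr 1
    ext x
    simp [smul_smul, mul_comm]

theorem IsStateCstar.inv_smul_smulFunctional {X : Type u} [TopologicalSpace X]
    {A : Type v} [NormedRing A] [StarRing A] [CStarRing A] [NormedAlgebra ℂ A] [StarModule ℂ A]
    {ρ : C(X, A) →ₗ[ℂ] ℂ} (hρ : IsStateCstar ρ) {h : C(X, ℂ)} (hh : ∀ x, 0 ≤ h x)
    {t : ℝ} (ht : 0 < t) (hρt : ρ (h • 1) = t) :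
    IsStateCstar ((t : ℂ)⁻¹ • smulFunctional ρ h) := by
  have ht' : (t : ℂ) ≠ 0 := by exact_mod_cast ht.ne'
  refine ⟨?_, fun b => ?_⟩
  · simp [smulFunctional, hρt, ht']
  · have := hρ.apply_smul_star_mul_self_nonneg hh b
    have h3 : (0 : ℂ) ≤ (t : ℂ)⁻¹ := by
      rw [← Complex.ofReal_inv]; exact_mod_cast (inv_pos.2 ht).le
    simpa [smulFunctional] using mul_nonneg h3 this

theorem IsPureStateCstar.apply_smul_of_bounds {X : Type u} [TopologicalSpace X]
    {A : Type v} [NormedRing A] [StarRing A] [CStarRing A] [NormedAlgebra ℂ A] [StarModule ℂ A]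
    {ρ : C(X, A) →ₗ[ℂ] ℂ} (hρ : IsPureStateCstar ρ) {f : C(X, ℝ)}
    (hf : ∀ x, 1 / 4 ≤ f x) (hf' : ∀ x, f x ≤ 3 / 4) {h : C(X, ℂ)} (hh : ∀ x, h x = f x)
    (b : C(X, A)) : ρ (h • b) = ρ (h • 1) * ρ b := by
  have nonneg (k : C(X, ℂ)) (hk : ∀ x, 0 ≤ k x) : 0 ≤ ρ (k • 1) := by
    have := hρ.1.apply_smul_star_mul_self_nonneg hk 1
    have one_eq : star (1 : C(X, A)) * 1 = 1 := by ext x; simp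
    rwa [one_eq] at this
  have const_smul (c : ℂ) (b : C(X, A)) : (ContinuousMap.const X c) • b = c • b := by
    ext x; simp
  have low : (1 / 4 : ℂ) ≤ ρ (h • 1) := by
    have := nonneg (h - ContinuousMap.const X (1 / 4)) fun x => by
      have : (0 : ℝ) ≤ f x - 1 / 4 := by linarith [hf x]
      have : (0 : ℂ) ≤ ((f x - 1 / 4 : ℝ) : ℂ) := by exact_mod_cast this
      simpa [hh] using this
    rw [scalar_sub_smul, const_smul, map_sub, ρ.map_smul, hρ.1.1] at this
    simpa using this
  have sub_eq (b : C(X, A)) : ((1 : C(X, ℂ)) - h) • b = b - h • b := by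
    rw [scalar_sub_smul, scalar_one_smul]
  have high : ρ (h • 1) ≤ (3 / 4 : ℂ) := by
    have := nonneg (ContinuousMap.const X (3 / 4) - h) fun x => by
      have : (0 : ℝ) ≤ 3 / 4 - f x := by linarith [hf' x]
      have : (0 : ℂ) ≤ ((3 / 4 - f x : ℝ) : ℂ) := by exact_mod_cast this
      simpa [hh] using this
    rw [scalar_sub_smul, const_smul, map_sub, ρ.map_smul, hρ.1.1] at this
    simpa using this
  obtain ⟨t, ht⟩ : ∃ t : ℝ, ρ (h • 1) = t := by
    refine ⟨(ρ (h • 1)).re, Complex.ext rfl ?_⟩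
    have := (Complex.le_def.1 low).2
    simpa using this.symm
  have t_pos : 0 < t := by
    have := (Complex.le_def.1 low).1
    rw [ht] at this
    norm_num at this
    linarith
  have t_lt : t < 1 := by
    have := (Complex.le_def.1 high).1
    rw [ht] at this
    norm_num at this
    linarith
  have hs₁ := hρ.1.inv_smul_smulFunctional (h := h) (fun x => by
    rw [hh]; exact_mod_cast (by linarith [hf x] : (0 : ℝ) ≤ f x)) t_pos ht
  have hs₂ := hρ.1.inv_smul_smulFunctional (h := 1 - h) (fun x => by
    have : (0 : ℂ) ≤ ((1 - f x : ℝ) : ℂ) := by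
      exact_mod_cast (by linarith [hf' x] : (0 : ℝ) ≤ 1 - f x)
    simpa [hh] using this) (sub_pos.2 t_lt) (by rw [sub_eq, map_sub, hρ.1.1, ht]; simp)
  have t_ne : (t : ℂ) ≠ 0 := by exact_mod_cast t_pos.ne'
  have one_sub_t_ne : ((1 - t : ℝ) : ℂ) ≠ 0 := by exact_mod_cast (sub_pos.2 t_lt).ne'
  have := (hρ.2 _ _ hs₁ hs₂ t t_pos t_lt (by
    rw [smul_inv_smul₀ t_ne, smul_inv_smul₀ one_sub_t_ne]
    ext b
    simp [smulFunctional, sub_eq])).1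
  have hb := LinearMap.congr_fun this b
  simp only [smulFunctional, LinearMap.smul_apply, LinearMap.coe_mk, AddHom.coe_mk,
    smul_eq_mul] at hb
  rw [ht, ← hb, mul_inv_cancel_left₀ t_ne]

theorem IsPureStateCstar.apply_smul {X : Type u} [TopologicalSpace X] [CompactSpace X]
    {A : Type v} [NormedRing A] [StarRing A] [CStarRing A] [NormedAlgebra ℂ A] [StarModule ℂ A]
    {ρ : C(X, A) →ₗ[ℂ] ℂ} (hρ : IsPureStateCstar ρ) (h : C(X, ℂ))
    (b : C(X, A)) : ρ (h • b) = ρ (h • 1) * ρ b := by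
  let toComplex (f : C(X, ℝ)) : C(X, ℂ) := ⟨fun x => (f x : ℂ), by fun_prop⟩
  have real_case (f : C(X, ℝ)) : ρ (toComplex f • b) = ρ (toComplex f • 1) * ρ b := by
    have hpos : 0 < 4 * (1 + ‖f‖) := by positivity
    set c : ℝ := (4 * (1 + ‖f‖))⁻¹ with hc
    have c_pos : 0 < c := inv_pos.2 hpos
    have hbound (x : X) : |c * f x| ≤ 1 / 4 := by
      rw [abs_mul, abs_of_pos c_pos, hc, inv_mul_le_iff₀ hpos]
      have := f.norm_coe_le_norm x
      rw [Real.norm_eq_abs] at this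
      linarith
    let k : C(X, ℝ) := ⟨fun x => 1 / 2 + c * f x, by fun_prop⟩
    have decomp (d : C(X, A)) :
        toComplex k • d = (1 / 2 : ℂ) • d + (c : ℂ) • (toComplex f • d) := by
      ext x
      simp [toComplex, k, add_smul, mul_smul]
    have := hρ.apply_smul_of_bounds (f := k) (h := toComplex k)
      (fun x => by have := abs_le.1 (hbound x); simp only [k, ContinuousMap.coe_mk]; linarith)
      (fun x => by have := abs_le.1 (hbound x); simp only [k, ContinuousMap.coe_mk]; linarith)
      (fun x => rfl) b
    rw [decomp, decomp, map_add, map_add, ρ.map_smul, ρ.map_smul, ρ.map_smul, ρ.map_smul, hρ.1.1] at this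
    simp only [smul_eq_mul] at this
    refine mul_left_cancel₀ (by exact_mod_cast c_pos.ne' : (c : ℂ) ≠ 0) ?_
    linear_combination this
  let re : C(X, ℝ) := ⟨fun x => (h x).re, by fun_prop⟩
  let im : C(X, ℝ) := ⟨fun x => (h x).im, by fun_prop⟩
  have decomp (d : C(X, A)) :
      h • d = toComplex re • d + Complex.I • (toComplex im • d) := by
    ext x
    simp only [toComplex, re, im, ContinuousMap.smul_apply', ContinuousMap.add_apply,
      ContinuousMap.smul_apply, ContinuousMap.coe_mk, smul_smul, ← add_smul]
    rw [mul_comm Complex.I, Complex.re_add_im]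
  rw [decomp, decomp, map_add, map_add, ρ.map_smul, ρ.map_smul, real_case, real_case]
  simp only [smul_eq_mul]
  ring

theorem IsPureStateCstar.exists_apply_smul_eq {X : Type u} [TopologicalSpace X] [CompactSpace X]
    [T2Space X] {A : Type v} [NormedRing A] [StarRing A] [CStarRing A] [NormedAlgebra ℂ A]
    [StarModule ℂ A] {ρ : C(X, A) →ₗ[ℂ] ℂ} (hρ : IsPureStateCstar ρ) :
    ∃ x₀ : X, ∀ (h : C(X, ℂ)) (b : C(X, A)), ρ (h • b) = h x₀ * ρ b := by
  let χ : C(X, ℂ) →ₐ[ℂ] ℂ := AlgHom.ofLinearMap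
    { toFun := fun h => ρ (h • 1)
      map_add' := fun h k => by rw [scalar_add_smul, map_add]
      map_smul' := fun c h => by rw [scalar_smul_smul, ρ.map_smul, RingHom.id_apply] }
    (by simpa [scalar_one_smul] using hρ.1.1)
    (fun h k => by
      change ρ ((h * k) • 1) = ρ (h • 1) * ρ (k • 1)
      rw [scalar_mul_smul, hρ.apply_smul])
  obtain ⟨x₀, hx₀⟩ := (WeakDual.CharacterSpace.continuousMapEval_bijective (X := X) (𝕜 := ℂ)).2
    (WeakDual.CharacterSpace.equivAlgHom.symm χ)
  refine ⟨x₀, fun h b => ?_⟩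
  rw [hρ.apply_smul]
  congr 1
  exact (DFunLike.congr_fun hx₀ h).symm

theorem continuous_inv_sqrt_norm_smul {A : Type v} [NormedAddCommGroup A] [NormedSpace ℂ A] :
    Continuous fun a : A => ((√‖a‖ : ℝ) : ℂ)⁻¹ • a := by
  rw [continuous_iff_continuousAt]
  intro a
  rcases eq_or_ne a 0 with rfl | ha
  · rw [ContinuousAt, smul_zero, tendsto_zero_iff_norm_tendsto_zero]
    have h : Filter.Tendsto (fun a : A => √‖a‖) (nhds 0) (nhds 0) :=
      (by fun_prop : Continuous fun a : A => √‖a‖).tendsto' _ _ (by simp)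
    refine h.congr fun a => ?_
    rw [norm_smul, norm_inv, Complex.norm_real, Real.norm_eq_abs,
      abs_of_nonneg (Real.sqrt_nonneg _), inv_mul_eq_div, Real.div_sqrt]
  · refine ContinuousAt.smul (ContinuousAt.inv₀ (by fun_prop) ?_) continuousAt_id
    simpa [Real.sqrt_eq_zero] using ha

theorem apply_eq_zero_of_apply_smul_eq {X : Type u} [TopologicalSpace X] {A : Type v}
    [NormedRing A] [NormedAlgebra ℂ A] {ρ : C(X, A) →ₗ[ℂ] ℂ} {x₀ : X}
    (hx₀ : ∀ (h : C(X, ℂ)) (b : C(X, A)), ρ (h • b) = h x₀ * ρ b) {f : C(X, A)}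
    (hf : f x₀ = 0) : ρ f = 0 := by
  let g : C(X, ℂ) := ⟨fun x => ((√‖f x‖ : ℝ) : ℂ), by fun_prop⟩
  let k : C(X, A) := ⟨fun x => ((√‖f x‖ : ℝ) : ℂ)⁻¹ • f x,
    continuous_inv_sqrt_norm_smul.comp f.continuous⟩
  have hgk : f = g • k := by
    ext x
    rcases eq_or_ne (f x) 0 with h | h
    · simp [g, k, h]
    · have : ((√‖f x‖ : ℝ) : ℂ) ≠ 0 := by simpa [Real.sqrt_eq_zero] using h
      exact (smul_inv_smul₀ this (f x)).symm
  rw [hgk, hx₀]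
  simp [g, hf]

/-- Every pure state `ρ` on `C(X, A)`, for `X` compact Hausdorff and `A` a
unital C*-algebra, is of the form `ρ(f) = φ(f(x₀))` for a pure state `φ` on `A` and a point
`x₀ ∈ X`. -/
theorem stmt_15 {X : Type u} [TopologicalSpace X] [CompactSpace X] [T2Space X]
    {A : Type v} [NormedRing A] [StarRing A] [CStarRing A] [CompleteSpace A]
    [NormedAlgebra ℂ A] [StarModule ℂ A]
    (ρ : C(X, A) →ₗ[ℂ] ℂ) (hρ : IsPureStateCstar ρ) :
    ∃ (φ : A →ₗ[ℂ] ℂ) (x₀ : X),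
      IsPureStateCstar φ ∧ ∀ f : C(X, A), ρ f = φ (f x₀) := by
  obtain ⟨x₀, hx₀⟩ := hρ.exists_apply_smul_eq
  let φ : A →ₗ[ℂ] ℂ :=
    { toFun := fun a => ρ (ContinuousMap.const X a)
      map_add' := fun a b => by rw [← map_add]; rfl
      map_smul' := fun c a => by rw [RingHom.id_apply, ← ρ.map_smul]; rfl }
  have apply_eq (f : C(X, A)) : ρ f = φ (f x₀) := by
    have := apply_eq_zero_of_apply_smul_eq hx₀
      (f := f - ContinuousMap.const X (f x₀)) (by simp)
    rw [map_sub] at this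
    exact sub_eq_zero.1 this
  let ev : C(X, A) →ₗ[ℂ] A :=
    { toFun := fun f => f x₀
      map_add' := fun _ _ => rfl
      map_smul' := fun _ _ => rfl }
  have state_comp {ψ : A →ₗ[ℂ] ℂ} (hψ : IsStateCstar ψ) : IsStateCstar (ψ ∘ₗ ev) :=
    ⟨hψ.1, fun b => hψ.2 (b x₀)⟩
  refine ⟨φ, x₀, ⟨⟨hρ.1.1, fun a => hρ.1.2 (ContinuousMap.const X a)⟩, ?_⟩, apply_eq⟩
  intro ψ₁ ψ₂ h₁ h₂ t ht ht' hφ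
  obtain ⟨e₁, e₂⟩ := hρ.2 _ _ (state_comp h₁) (state_comp h₂) t ht ht' (by
    ext f
    rw [apply_eq, hφ]
    rfl)
  exact ⟨LinearMap.ext fun a => LinearMap.congr_fun e₁ (ContinuousMap.const X a),
    LinearMap.ext fun a => LinearMap.congr_fun e₂ (ContinuousMap.const X a)⟩
end
end
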